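/- Every root of Λ is either nodal or chordal: if r ∈ Λ satisfies ⟨r,r⟩ = 3, then the set {⟨r,x⟩ : x ∈ Λ} equals either θℰ or 3ℰ. -/

import Mathlib

noncomputable section

/-- The primitive cube root of unity `ω = e^{2πi/3}`. -/
def ω : ℂ := ⟨-1/2, Real.sqrt 3 / 2⟩

/-- `θ = ω - ω̄`, a square root of `-3`. -/
def θ : ℂ := ω - (starRingEnd ℂ) ω

/-- The ring of Eisenstein integers `ℰ = ℤ[ω]` as a subring of ℂ. -/
def Eis : Subring ℂ := Subring.closure {ω}

/-- The Gram matrix of `E₈^ℰ`. -/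
def Bmat : Matrix (Fin 4) (Fin 4) ℂ :=
  !![3, θ, 0, 0; -θ, 3, θ, 0; 0, -θ, 3, θ; 0, 0, -θ, 3]

/-- The Gram matrix of the hyperbolic cell `H`. -/
def Cmat : Matrix (Fin 2) (Fin 2) ℂ := !![0, θ; -θ, 0]

/-- The Gram matrix of `Λ₁₀`: block diagonal with blocks B, B, C. -/
def Lam10 : Matrix (Fin 10) (Fin 10) ℂ := Matrix.of fun i j =>
  if h : i.val < 4 ∧ j.val < 4 then Bmat ⟨i.val, h.1⟩ ⟨j.val, h.2⟩
  else if h : 4 ≤ i.val ∧ i.val < 8 ∧ 4 ≤ j.val ∧ j.val < 8 then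
    Bmat ⟨i.val - 4, by omega⟩ ⟨j.val - 4, by omega⟩
  else if h : 8 ≤ i.val ∧ 8 ≤ j.val then
    Cmat ⟨i.val - 8, by have := i.isLt; omega⟩ ⟨j.val - 8, by have := j.isLt; omega⟩
  else 0

/-- The Gram matrix of `Λ = (3) ⊕ Λ₁₀`: block diagonal with blocks (3), B, B, C. -/
def Lam11 : Matrix (Fin 11) (Fin 11) ℂ := Matrix.of fun i j =>
  if i.val = 0 ∧ j.val = 0 then 3
  else if h : 1 ≤ i.val ∧ 1 ≤ j.val then
    Lam10 ⟨i.val - 1, by have := i.isLt; omega⟩ ⟨j.val - 1, by have := j.isLt; omega⟩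
  else 0

/-- The Hermitian form of `Λ`, on vectors with complex entries. -/
def herm11C (x y : Fin 11 → ℂ) : ℂ :=
  ∑ i : Fin 11, ∑ j : Fin 11, Lam11 i j * x i * (starRingEnd ℂ) (y j)

/-- The ideal `θℰ ⊆ ℂ`. -/
def thetaEis : Set ℂ := {z | ∃ e : Eis, z = θ * (e : ℂ)}

/-- The ideal `3ℰ ⊆ ℂ`. -/
def threeEis : Set ℂ := {z | ∃ e : Eis, z = 3 * (e : ℂ)}

/-- The set `{⟨r,x⟩ : x ∈ Λ}` of inner products of `r` with lattice vectors. -/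
def innerSet (r : Fin 11 → ℂ) : Set ℂ :=
  {c | ∃ x : Fin 11 → ℂ, (∀ i, x i ∈ Eis) ∧ c = herm11C r x}

theorem omega_sq : ω ^ 2 = -1 - ω := by
  have h : Real.sqrt 3 * Real.sqrt 3 = 3 := Real.mul_self_sqrt (by norm_num)
  rw [pow_two]
  apply Complex.ext
  · simp only [ω, Complex.mul_re, Complex.sub_re, Complex.neg_re, Complex.one_re]
    linarith
  · simp only [ω, Complex.mul_im, Complex.sub_im, Complex.neg_im, Complex.one_im]
    ring

theorem conj_omega : (starRingEnd ℂ) ω = -1 - ω := by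
  apply Complex.ext <;>
    simp only [ω, Complex.conj_re, Complex.conj_im, Complex.sub_re, Complex.sub_im,
      Complex.neg_re, Complex.neg_im, Complex.one_re, Complex.one_im] <;> ring

theorem theta_eq : θ = 1 + 2 * ω := by
  rw [θ, conj_omega]
  ring

theorem theta_sq : θ ^ 2 = -3 := by
  rw [theta_eq]
  linear_combination 4 * omega_sq

theorem omega_mem : ω ∈ Eis := Subring.subset_closure rfl

theorem theta_mem : θ ∈ Eis := by
  rw [theta_eq, two_mul]
  exact add_mem (one_mem _) (add_mem omega_mem omega_mem)

theorem conj_mem {z : ℂ} (hz : z ∈ Eis) : (starRingEnd ℂ) z ∈ Eis := by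
  refine (Subring.closure_le (t := Eis.comap (starRingEnd ℂ))).2 ?_ hz
  rintro _ rfl
  change (starRingEnd ℂ) ω ∈ Eis
  rw [conj_omega]
  exact sub_mem (neg_mem (one_mem _)) omega_mem

/-- Every Eisenstein integer is congruent modulo `θ` to a rational integer. -/
theorem exists_int_add_theta_mul {z : ℂ} (hz : z ∈ Eis) :
    ∃ n : ℤ, ∃ w ∈ Eis, z = n + θ * w := by
  induction hz using Subring.closure_induction with
  | mem x hx =>
    obtain rfl : x = ω := hx
    refine ⟨1, 1 + ω, add_mem (one_mem _) omega_mem, ?_⟩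
    rw [theta_eq]
    push_cast
    linear_combination -2 * omega_sq
  | zero => exact ⟨0, 0, zero_mem _, by simp⟩
  | one => exact ⟨1, 0, zero_mem _, by simp⟩
  | add x y _ _ hx hy =>
    obtain ⟨m, v, hv, rfl⟩ := hx
    obtain ⟨n, w, hw, rfl⟩ := hy
    exact ⟨m + n, v + w, add_mem hv hw, by push_cast; ring⟩
  | neg x _ hx =>
    obtain ⟨m, v, hv, rfl⟩ := hx
    exact ⟨-m, -v, neg_mem hv, by push_cast; ring⟩
  | mul x y _ _ hx hy =>
    obtain ⟨m, v, hv, rfl⟩ := hx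
    obtain ⟨n, w, hw, rfl⟩ := hy
    refine ⟨m * n, m * w + v * n + θ * (v * w), ?_, by push_cast; ring⟩
    exact add_mem (add_mem (mul_mem (intCast_mem _ _) hw) (mul_mem hv (intCast_mem _ _)))
      (mul_mem theta_mem (mul_mem hv hw))

/-- The residue field of `ℰ` at `θ` has the three elements `0, 1, -1`. -/
theorem theta_residue {z : ℂ} (hz : z ∈ Eis) :
    ∃ w ∈ Eis, z = θ * w ∨ z = 1 + θ * w ∨ z = -1 + θ * w := by
  obtain ⟨n, w, hw, rfl⟩ := exists_int_add_theta_mul hz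
  obtain ⟨k, hk⟩ : ∃ k : ℤ, n = 3 * k ∨ n = 1 + 3 * k ∨ n = -1 + 3 * k :=
    ⟨(n + 1) / 3, by omega⟩
  refine ⟨w - θ * k, sub_mem hw (mul_mem theta_mem (intCast_mem _ _)), ?_⟩
  rcases hk with rfl | rfl | rfl
  · left
    push_cast
    linear_combination k * theta_sq
  · right; left
    push_cast
    linear_combination k * theta_sq
  · right; right
    push_cast
    linear_combination k * theta_sq

/-- An `ℰ`-submodule of `θℰ` containing `3` is `θℰ` or `3ℰ`. -/
theorem eq_thetaEis_or_eq_threeEis {J : Set ℂ} (hadd : ∀ a ∈ J, ∀ b ∈ J, a + b ∈ J)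
    (hmul : ∀ e ∈ Eis, ∀ a ∈ J, e * a ∈ J) (h3 : (3 : ℂ) ∈ J) (hJ : J ⊆ thetaEis) :
    J = thetaEis ∨ J = threeEis := by
  by_cases hθ : θ ∈ J
  · left
    refine hJ.antisymm ?_
    rintro _ ⟨e, rfl⟩
    rw [mul_comm]
    exact hmul _ e.2 _ hθ
  · right
    apply Set.Subset.antisymm
    · intro c hc
      obtain ⟨e, rfl⟩ := hJ hc
      obtain ⟨w, hw, h⟩ := theta_residue e.2
      have hmem := hadd _ hc _ (hmul w hw _ h3)
      rcases h with h | h | h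
      · exact ⟨⟨-w, neg_mem hw⟩, by rw [h]; linear_combination w * theta_sq⟩
      · refine absurd ?_ hθ
        convert hmem using 1
        rw [h]
        linear_combination -w * theta_sq
      · refine absurd ?_ hθ
        convert hmul (-1) (neg_mem (one_mem _)) _ hmem using 1
        rw [h]
        linear_combination w * theta_sq
    · rintro _ ⟨e, rfl⟩
      rw [mul_comm]
      exact hmul _ e.2 _ h3

theorem theta_mul_mem_thetaEis {e : ℂ} (he : e ∈ Eis) : θ * e ∈ thetaEis := ⟨⟨e, he⟩, rfl⟩

theorem zero_mem_thetaEis : (0 : ℂ) ∈ thetaEis := ⟨0, by simp⟩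

theorem three_mem_thetaEis : (3 : ℂ) ∈ thetaEis :=
  ⟨⟨-θ, neg_mem theta_mem⟩, by linear_combination theta_sq⟩

theorem theta_mem_thetaEis : θ ∈ thetaEis := ⟨1, by simp⟩

theorem neg_theta_mem_thetaEis : -θ ∈ thetaEis := ⟨-1, by simp⟩

theorem Bmat_mem_thetaEis (i j : Fin 4) : Bmat i j ∈ thetaEis := by
  fin_cases i <;> fin_cases j <;>
    simp [Bmat, zero_mem_thetaEis, three_mem_thetaEis, theta_mem_thetaEis, neg_theta_mem_thetaEis]

theorem Cmat_mem_thetaEis (i j : Fin 2) : Cmat i j ∈ thetaEis := by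
  fin_cases i <;> fin_cases j <;>
    simp [Cmat, zero_mem_thetaEis, theta_mem_thetaEis, neg_theta_mem_thetaEis]

theorem Lam11_mem_thetaEis (i j : Fin 11) : Lam11 i j ∈ thetaEis := by
  simp only [Lam11, Lam10, Matrix.of_apply]
  split_ifs <;>
    first
    | exact three_mem_thetaEis
    | exact zero_mem_thetaEis
    | exact Bmat_mem_thetaEis _ _
    | exact Cmat_mem_thetaEis _ _

theorem herm11C_mem_thetaEis {x y : Fin 11 → ℂ} (hx : ∀ i, x i ∈ Eis) (hy : ∀ i, y i ∈ Eis) :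
    herm11C x y ∈ thetaEis := by
  choose e he using Lam11_mem_thetaEis
  have h : herm11C x y = θ * ∑ i, ∑ j, (e i j : ℂ) * x i * (starRingEnd ℂ) (y j) := by
    simp only [herm11C, he, Finset.mul_sum, mul_assoc]
  rw [h]
  exact theta_mul_mem_thetaEis (sum_mem fun i _ => sum_mem fun j _ =>
    mul_mem (mul_mem (e i j).2 (hx i)) (conj_mem (hy j)))

theorem herm11C_add_right (x y z : Fin 11 → ℂ) :
    herm11C x (y + z) = herm11C x y + herm11C x z := by
  simp only [herm11C, Pi.add_apply, map_add, mul_add, Finset.sum_add_distrib]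

theorem herm11C_conj_smul_right (x y : Fin 11 → ℂ) (c : ℂ) :
    herm11C x ((starRingEnd ℂ) c • y) = c * herm11C x y := by
  simp only [herm11C, Pi.smul_apply, smul_eq_mul, map_mul, Complex.conj_conj, Finset.mul_sum,
    mul_left_comm c]

/-- Every root of `Λ` is either nodal or chordal: if `r ∈ Λ` has
`⟨r,r⟩ = 3`, then `{⟨r,x⟩ : x ∈ Λ}` is `θℰ` or `3ℰ`. -/
theorem stmt_7 :
    ∀ r : Fin 11 → ℂ, (∀ i, r i ∈ Eis) → herm11C r r = 3 →
      innerSet r = thetaEis ∨ innerSet r = threeEis := by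
  intro r hr hrr
  apply eq_thetaEis_or_eq_threeEis
  · rintro _ ⟨x, hx, rfl⟩ _ ⟨y, hy, rfl⟩
    exact ⟨x + y, fun i => add_mem (hx i) (hy i), (herm11C_add_right r x y).symm⟩
  · rintro e he _ ⟨x, hx, rfl⟩
    exact ⟨(starRingEnd ℂ) e • x, fun i => mul_mem (conj_mem he) (hx i),
      (herm11C_conj_smul_right r x e).symm⟩
  · exact ⟨r, hr, hrr.symm⟩
  · rintro _ ⟨x, hx, rfl⟩
    exact herm11C_mem_thetaEis hr hx
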